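/- arXiv:1312.3176 — 2 statements merged into one kernel-verified Lean document; each statement's English description precedes it below -/
import Mathlib

section
/- Corollary 2 (uniqueness of the electrostatic center): there is a unique point P of the plane such that P lies in the interior of T and gradient V P = 0; moreover V attains its global maximum at a unique point, namely this P (i.e. there is a unique P with V Q ≤ V P for all Q). -/
open MeasureTheory

section Potential

open Set Metric Topology

/-- The Euclidean plane. -/
abbrev Plane := EuclideanSpace ℝ (Fin 2)

/-- The potential at `P` of a uniform charge on `K`, for the kernel `1 / r`. -/
noncomputable def coulombPotential (K : Set Plane) (P : Plane) : ℝ :=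
  ∫ Q in K, (dist P Q)⁻¹

theorem integrableOn_inv_norm_ball (r : ℝ) :
    IntegrableOn (fun x : Plane => ‖x‖⁻¹) (ball 0 r) := by
  rw [integrableOn_fun_norm_addHaar volume (f := fun y : ℝ => y⁻¹)]
  have h : IntegrableOn (fun _ : ℝ => (1 : ℝ)) (Ioo 0 r) := by simp
  refine h.congr_fun (fun y hy => ?_) measurableSet_Ioo
  have hy0 : y ≠ 0 := hy.1.ne'
  simp [hy0]

theorem locallyIntegrable_inv_norm : LocallyIntegrable (fun x : Plane => ‖x‖⁻¹) := by
  intro x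
  exact ⟨ball 0 (‖x‖ + 1), isOpen_ball.mem_nhds (by simp), integrableOn_inv_norm_ball _⟩

theorem integrableOn_inv_dist {K : Set Plane} (hK : Bornology.IsBounded K) (P : Plane) :
    IntegrableOn (fun Q : Plane => (dist P Q)⁻¹) K := by
  obtain ⟨r, hr⟩ := hK.subset_ball P
  refine IntegrableOn.mono_set ?_ hr
  have h := (measurePreserving_sub_right volume P).integrableOn_comp_preimage
    (MeasurableEquiv.subRight P).measurableEmbedding
    (f := fun x : Plane => ‖x‖⁻¹) (s := ball 0 r)
  have h2 := h.2 (integrableOn_inv_norm_ball r)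
  have h3 : (fun x : Plane => x - P) ⁻¹' ball 0 r = ball P r := by
    ext x; simp [dist_eq_norm]
  rw [h3] at h2
  refine h2.congr_fun (fun x _ => ?_) measurableSet_ball
  simp [dist_eq_norm, norm_sub_rev]

theorem coulombPotential_eq_integral_indicator {K : Set Plane} (hK : MeasurableSet K) (P : Plane) :
    coulombPotential K P = ∫ y, K.indicator (fun _ => (1 : ℝ)) (P - y) * ‖y‖⁻¹ := by
  rw [coulombPotential, ← integral_indicator hK, ← integral_sub_left_eq_self _ volume P]
  congr 1 with y
  by_cases h : P - y ∈ K <;> simp [h, dist_eq_norm]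

theorem continuous_coulombPotential {K : Set Plane} (hK : IsCompact K) (hc : Convex ℝ K) :
    Continuous (coulombPotential K) := by
  rw [funext (coulombPotential_eq_integral_indicator hK.measurableSet), continuous_iff_continuousAt]
  intro P
  obtain ⟨r, hr⟩ := hK.isBounded.subset_ball P
  refine continuousAt_of_dominated
    (bound := (ball 0 (r + 1)).indicator fun y : Plane => ‖y‖⁻¹) ?_ ?_ ?_ ?_
  · refine .of_forall fun P' => Measurable.aestronglyMeasurable ?_
    exact ((measurable_const.indicator hK.measurableSet).comp (measurable_const.sub measurable_id)).mul
      measurable_norm.inv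
  · filter_upwards [ball_mem_nhds P one_pos] with P' hP'
    refine .of_forall fun y => ?_
    by_cases h : P' - y ∈ K
    · have hy : y ∈ ball (0 : Plane) (r + 1) := by
        have h1 := hr h
        rw [mem_ball, dist_eq_norm] at h1 hP'
        rw [mem_ball_zero_iff]
        calc ‖y‖ = ‖(P' - P) - (P' - y - P)‖ := by congr 1; abel
          _ ≤ ‖P' - P‖ + ‖P' - y - P‖ := norm_sub_le _ _
          _ < r + 1 := by linarith
      simp [h, hy]
    · simp only [h, not_false_eq_true, indicator_of_notMem, zero_mul, norm_zero]
      exact indicator_nonneg (fun _ _ => by positivity) _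
  · exact (integrable_indicator_iff measurableSet_ball).2 (integrableOn_inv_norm_ball _)
  · have h0 : ∀ᵐ y : Plane, P - y ∉ frontier K := by
      have := (Measure.measurePreserving_sub_left volume P).quasiMeasurePreserving.ae
        (p := fun y => y ∉ frontier K) (measure_eq_zero_iff_ae_notMem.1 (hc.addHaar_frontier volume))
      exact this
    filter_upwards [h0] with y hy
    refine ContinuousAt.mul ?_ continuousAt_const
    have hcont : ContinuousAt (K.indicator fun _ => (1 : ℝ)) (P - y) :=
      continuousOn_const.continuousAt_indicator hy
    exact ContinuousAt.comp (f := fun x => x - y) hcont (by fun_prop)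

/-- Orthogonal projection onto a convex body increases the potential. -/
theorem exists_mem_coulombPotential_lt {K : Set Plane} (hK : IsCompact K) (hc : Convex ℝ K)
    (hi : (interior K).Nonempty) {Q : Plane} (hQ : Q ∉ K) :
    ∃ P ∈ K, coulombPotential K Q < coulombPotential K P := by
  obtain ⟨P, hP, hPQ⟩ := exists_norm_eq_iInf_of_complete_convex (hi.mono interior_subset)
    hK.isComplete hc Q
  rw [norm_eq_iInf_iff_real_inner_le_zero hc hP] at hPQ
  have hne : P ≠ Q := fun h => hQ (h ▸ hP)
  have hdist : ∀ X ∈ K, dist P X < dist Q X := by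
    intro X hX
    have h1 := hPQ X hX
    have h2 : ‖Q - X‖ ^ 2 = ‖Q - P‖ ^ 2 - 2 * inner ℝ (Q - P) (X - P) + ‖X - P‖ ^ 2 := by
      rw [← norm_sub_sq_real]; congr 2; abel
    have h3 : 0 < ‖Q - P‖ := norm_pos_iff.2 (sub_ne_zero.2 hne.symm)
    rw [dist_comm P X, dist_eq_norm, dist_eq_norm]
    refine lt_of_pow_lt_pow_left₀ 2 (norm_nonneg _) ?_
    nlinarith
  refine ⟨P, hP, ?_⟩
  have hpos : ∀ X ∈ K, X ≠ P → (dist Q X)⁻¹ < (dist P X)⁻¹ := fun X hX hXP =>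
    inv_strictAnti₀ (dist_pos.2 hXP.symm) (hdist X hX)
  have hIP := integrableOn_inv_dist hK.isBounded P
  have hIQ := integrableOn_inv_dist hK.isBounded Q
  rw [← sub_pos, coulombPotential, coulombPotential, ← integral_sub hIP hIQ]
  have hae : ∀ᵐ X ∂(volume.restrict K), X ∈ K ∧ X ≠ P := by
    have : ∀ᵐ X : Plane, X ≠ P := by simp [ae_iff]
    filter_upwards [ae_restrict_mem hK.measurableSet, ae_restrict_of_ae this] with X h h' using ⟨h, h'⟩
  refine (setIntegral_pos_iff_support_of_nonneg_ae ?_ (hIP.sub hIQ)).2 ?_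
  · filter_upwards [hae] with X hX
    exact (sub_pos.2 (hpos X hX.1 hX.2)).le
  · have hKpos : 0 < volume (K \ {P}) := by
      rw [measure_sdiff_null (by simp)]
      exact Measure.measure_pos_of_nonempty_interior _ hi
    refine hKpos.trans_le (measure_mono fun X hX => ⟨?_, hX.1⟩)
    exact (sub_pos.2 (hpos X hX.1 hX.2)).ne'

end Potential

section Differentiability

open Set Metric Topology

theorem differentiableAt_coulombPotential {K : Set Plane} (hK : IsCompact K)
    {P : Plane} (hP : P ∈ interior K) : DifferentiableAt ℝ (coulombPotential K) P := by
  obtain ⟨δ, hδ, hball⟩ := Metric.isOpen_iff.1 isOpen_interior P hP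
  obtain ⟨r, hr⟩ := hK.isBounded.subset_ball P
  have hr0 : 0 < r := pos_of_mem_ball (hr (interior_subset hP))
  let χ : ContDiffBump (0 : Plane) := ⟨δ / 4, δ / 2, by positivity, by linarith⟩
  let η : ContDiffBump (0 : Plane) := ⟨r + δ, r + δ + 1, by positivity, by linarith⟩
  let g : Plane → ℝ := fun x => η x * ((1 - χ x) * ‖x‖⁻¹)
  have hg : ContDiff ℝ 1 g := by
    refine η.contDiff.mul (contDiff_iff_contDiffAt.2 fun x => ?_)
    by_cases hx : x = 0
    · subst hx
      refine (contDiffAt_const (c := (0 : ℝ))).congr_of_eventuallyEq ?_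
      filter_upwards [χ.eventuallyEq_one] with y hy
      simp [hy]
    · exact (contDiffAt_const.sub χ.contDiffAt).mul
        ((contDiffAt_norm ℝ hx).inv (norm_ne_zero_iff.2 hx))
  have hgs : HasCompactSupport g := η.hasCompactSupport.mul_right
  have hloc : LocallyIntegrable (K.indicator fun _ : Plane => (1 : ℝ)) :=
    ((integrable_indicator_iff hK.measurableSet).2
      (integrableOn_const hK.measure_lt_top.ne)).locallyIntegrable
  have hconv := hgs.contDiff_convolution_right (n := 1) (ContinuousLinearMap.mul ℝ ℝ) hloc hg
  have hdiff := (hconv.differentiable (by simp)).differentiableAt (x := P)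
  refine (hdiff.const_add (∫ y, χ y * ‖y‖⁻¹)).congr_of_eventuallyEq ?_
  filter_upwards [ball_mem_nhds P (half_pos hδ)] with P' hP'
  have hInt : Integrable fun y : Plane => χ y * ‖y‖⁻¹ := by
    have := (locallyIntegrable_inv_norm.integrable_smul_left_of_hasCompactSupport
      χ.continuous χ.hasCompactSupport)
    exact this
  have hInt2 : Integrable fun y : Plane => K.indicator (fun _ => (1 : ℝ)) (P' - y) * g y := by
    have h1 : Integrable g := hg.continuous.integrable_of_hasCompactSupport hgs
    refine h1.bdd_mul (c := 1) ?_ (.of_forall fun y => ?_)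
    · exact ((measurable_const.indicator hK.measurableSet).comp
        (measurable_const.sub measurable_id)).aestronglyMeasurable
    · by_cases h : P' - y ∈ K <;> simp [h]
  have hswap : (MeasureTheory.convolution (K.indicator fun _ : Plane => (1 : ℝ)) g
      (ContinuousLinearMap.mul ℝ ℝ) volume) P' =
      ∫ y, K.indicator (fun _ => (1 : ℝ)) (P' - y) * g y := by
    rw [convolution_def, ← integral_sub_left_eq_self _ volume P']
    simp
  rw [hswap, coulombPotential_eq_integral_indicator hK.measurableSet, ← integral_add hInt hInt2]
  congr 1 with y
  have hPP : ‖P' - P‖ < δ / 2 := by rwa [mem_ball, dist_eq_norm] at hP'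
  by_cases h : P' - y ∈ K
  · have hη : η y = 1 := by
      refine η.one_of_mem_closedBall ?_
      have h1 := hr h
      rw [mem_ball, dist_eq_norm] at h1
      rw [mem_closedBall_zero_iff]
      calc ‖y‖ = ‖(P' - P) - (P' - y - P)‖ := by congr 1; abel
        _ ≤ ‖P' - P‖ + ‖P' - y - P‖ := norm_sub_le _ _
        _ ≤ r + δ := by linarith
    simp only [h, indicator_of_mem, one_mul, g, hη]
    ring
  · have hχ : χ y = 0 := by
      refine χ.zero_of_le_dist ?_
      rw [dist_zero_right]
      by_contra! hlt
      have hlt' : ‖y‖ < δ / 2 := hlt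
      refine h (interior_subset (hball ?_))
      rw [mem_ball, dist_eq_norm]
      calc ‖P' - y - P‖ = ‖(P' - P) - y‖ := by congr 1; abel
        _ ≤ ‖P' - P‖ + ‖y‖ := norm_sub_le _ _
        _ < δ := by linarith
    simp [h, hχ]

end Differentiability

section Polar

open Set Metric Topology

/-- The potential as the mean radius of `K` as seen from `P`. -/
theorem coulombPotential_eq_integral_sphere {K : Set Plane} (hK : MeasurableSet K) {P : Plane}
    {ρ : sphere (0 : Plane) 1 → ℝ} (hρc : Measurable ρ) (hρ0 : ∀ u, 0 ≤ ρ u)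
    (hρ : ∀ (u : sphere (0 : Plane) 1) r, 0 < r → (P + r • (u : Plane) ∈ K ↔ r ≤ ρ u)) :
    coulombPotential K P = ∫ u, ρ u ∂(volume : Measure Plane).toSphere := by
  rw [integral_eq_lintegral_of_nonneg_ae (.of_forall hρ0) hρc.aestronglyMeasurable,
    coulombPotential, integral_eq_lintegral_of_nonneg_ae (.of_forall fun _ => by positivity)
      (by fun_prop)]
  congr 1
  let F : Plane → ENNReal := fun y => K.indicator (fun _ => (1 : ENNReal)) (P + y) *
    ENNReal.ofReal ‖y‖⁻¹
  have hF : Measurable F :=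
    ((measurable_const.indicator hK).comp (measurable_const.add measurable_id)).mul
      measurable_norm.inv.ennreal_ofReal
  have h1 : ∫⁻ Q in K, ENNReal.ofReal (dist P Q)⁻¹ = ∫⁻ y, F y := by
    rw [← lintegral_indicator hK, ← lintegral_add_left_eq_self _ P]
    congr 1 with y
    by_cases h : P + y ∈ K <;> simp [h, F, dist_eq_norm]
  have h2 : ∫⁻ y, F y = ∫⁻ y : ({0}ᶜ : Set Plane), F y ∂(Measure.comap Subtype.val volume) := by
    rw [lintegral_subtype_comap (measurableSet_singleton _).compl, restrict_compl_singleton]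
  let e := homeomorphUnitSphereProd Plane
  have hmp := (volume : Measure Plane).measurePreserving_homeomorphUnitSphereProd
  have h3 : ∫⁻ y : ({0}ᶜ : Set Plane), F y ∂(Measure.comap Subtype.val volume) =
      ∫⁻ z : sphere (0 : Plane) 1 × Ioi (0 : ℝ), F ((z.2 : ℝ) • (z.1 : Plane))
        ∂((volume : Measure Plane).toSphere.prod (Measure.volumeIoiPow 1)) := by
    have hd : Module.finrank ℝ Plane - 1 = 1 := by simp
    rw [hd] at hmp
    rw [← hmp.lintegral_comp_emb (Homeomorph.measurableEmbedding _)]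
    congr 1 with y
    congr 1
    exact (congrArg Subtype.val (e.symm_apply_apply y)).symm
  rw [h1, h2, h3, lintegral_prod]
  · congr 1 with u
    rw [Measure.volumeIoiPow, lintegral_withDensity_eq_lintegral_mul]
    · have h4 : ∀ r : Ioi (0 : ℝ), ((fun r : Ioi (0 : ℝ) => ENNReal.ofReal (r.1 ^ 1)) *
          fun r : Ioi (0 : ℝ) => F ((r : ℝ) • (u : Plane))) r =
          (Iic (ρ u)).indicator (fun _ => (1 : ENNReal)) (r : ℝ) := by
        rintro ⟨r, hr⟩
        have hr' : 0 < r := hr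
        have hu : ‖(u : Plane)‖ = 1 := by simp
        by_cases h : r ≤ ρ u
        · have hm := (hρ u r hr').2 h
          simp only [Pi.mul_apply, F, hm, indicator_of_mem, mem_Iic, h, norm_smul, hu,
            Real.norm_eq_abs, abs_of_pos hr', one_mul, mul_one, pow_one]
          rw [← ENNReal.ofReal_mul hr'.le, mul_inv_cancel₀ hr'.ne', ENNReal.ofReal_one]
        · have hm := mt (hρ u r hr').1 h
          simp [F, hm, h]
      rw [lintegral_congr h4, lintegral_subtype_comap measurableSet_Ioi
        (fun r => (Iic (ρ u)).indicator (fun _ => (1 : ENNReal)) r),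
        lintegral_indicator measurableSet_Iic]
      simp [Measure.restrict_apply, Iic_inter_Ioi]
    · fun_prop
    · exact hF.comp (by fun_prop)
  · exact (hF.comp (by fun_prop)).aemeasurable

end Polar

section Concavity

open Set Metric Topology

variable {ι : Type*} (b : AffineBasis ι ℝ Plane)

theorem AffineBasis.coord_add_smul (i : ι) (P u : Plane) (r : ℝ) :
    b.coord i (P + r • u) = b.coord i P + r * (b.coord i).linear u := by
  rw [add_comm, ← vadd_eq_add, AffineMap.map_vadd]
  simp [add_comm]

theorem AffineBasis.coord_combo (i : ι) (P Q : Plane) {s t : ℝ} (hst : s + t = 1) :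
    b.coord i (s • P + t • Q) = s * b.coord i P + t * b.coord i Q := by
  have := Convex.combo_affine_apply (f := b.coord i) (x := P) (y := Q) hst
  simpa using this

theorem AffineBasis.combo_coord_pos {b : AffineBasis ι ℝ Plane} {P Q : Plane} (hP : ∀ i, 0 < b.coord i P)
    (hQ : ∀ i, 0 < b.coord i Q) {s t : ℝ} (hs : 0 < s) (ht : 0 < t) (hst : s + t = 1) (i : ι) :
    0 < b.coord i (s • P + t • Q) := by
  rw [b.coord_combo i P Q hst]
  have := hP i
  have := hQ i
  positivity

variable [Fintype ι]

theorem AffineBasis.isCompact_convexHull : IsCompact (convexHull ℝ (range b)) :=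
  (finite_range b).isCompact_convexHull ℝ

theorem AffineBasis.exists_linear_coord_neg (u : Plane) (hu : u ≠ 0) :
    ∃ i, (b.coord i).linear u < 0 := by
  by_contra! h
  have hsum : ∑ i, (b.coord i).linear u = 0 := by
    have h1 : ∀ i, (b.coord i).linear u = b.coord i u - b.coord i 0 := by
      intro i
      have := b.coord_add_smul i 0 u 1
      simp only [zero_add, one_smul, one_mul] at this
      linarith
    rw [Finset.sum_congr rfl fun i _ => h1 i, Finset.sum_sub_distrib, b.sum_coord_apply_eq_one,
      b.sum_coord_apply_eq_one, sub_self]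
  have h0 := (Finset.sum_eq_zero_iff_of_nonneg fun i _ => h i).1 hsum
  refine hu (b.ext_elem (fun i => ?_) : u = 0)
  have := b.coord_add_smul i 0 u 1
  rwa [h0 i (Finset.mem_univ i), zero_add, one_smul, mul_zero, add_zero] at this

/-- The distance from `P` to the boundary of the simplex in the direction `u`. -/
noncomputable def AffineBasis.radius [Nonempty ι] (P u : Plane) : ℝ :=
  (Finset.univ.sup' Finset.univ_nonempty fun i => -(b.coord i).linear u / b.coord i P)⁻¹

variable [Nonempty ι] {b}

theorem AffineBasis.sup_pos {P u : Plane} (hP : ∀ i, 0 < b.coord i P) (hu : u ≠ 0) :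
    0 < Finset.univ.sup' Finset.univ_nonempty fun i => -(b.coord i).linear u / b.coord i P := by
  obtain ⟨i, hi⟩ := b.exists_linear_coord_neg u hu
  exact (Finset.lt_sup'_iff _).2 ⟨i, Finset.mem_univ i, div_pos (neg_pos.2 hi) (hP i)⟩

theorem AffineBasis.add_smul_mem_iff {P u : Plane} (hP : ∀ i, 0 < b.coord i P) (hu : u ≠ 0)
    {r : ℝ} (hr : 0 < r) :
    P + r • u ∈ convexHull ℝ (range b) ↔ r ≤ b.radius P u := by
  rw [b.convexHull_eq_nonneg_coord, AffineBasis.radius, le_inv_comm₀ hr (sup_pos hP hu),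
    Finset.sup'_le_iff]
  simp only [mem_ofPred_eq, b.coord_add_smul, Finset.mem_univ, true_imp_iff]
  refine forall_congr' fun i => ?_
  rw [div_le_iff₀ (hP i), inv_mul_eq_div, le_div_iff₀ hr]
  constructor <;> intro h <;> linarith

theorem AffineBasis.continuous_radius {P : Plane} (hP : ∀ i, 0 < b.coord i P) :
    Continuous fun u : sphere (0 : Plane) 1 => b.radius P u := by
  refine Continuous.inv₀ (Continuous.finset_sup'_apply _ fun i _ => ?_) fun u =>
    (sup_pos hP (ne_zero_of_mem_unit_sphere u)).ne'
  have : Continuous (b.coord i).linear := LinearMap.continuous_of_finiteDimensional _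
  fun_prop

theorem AffineBasis.radius_pos {P u : Plane} (hP : ∀ i, 0 < b.coord i P) (hu : u ≠ 0) :
    0 < b.radius P u := inv_pos.2 (sup_pos hP hu)

theorem AffineBasis.coulombPotential_eq {P : Plane} (hP : ∀ i, 0 < b.coord i P) :
    coulombPotential (convexHull ℝ (range b)) P =
      ∫ u : sphere (0 : Plane) 1, b.radius P u ∂(volume : Measure Plane).toSphere :=
  coulombPotential_eq_integral_sphere b.isCompact_convexHull.measurableSet
    (continuous_radius hP).measurable
    (fun u => (radius_pos hP (ne_zero_of_mem_unit_sphere u)).le)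
    fun u _ hr => add_smul_mem_iff hP (ne_zero_of_mem_unit_sphere u) hr

theorem AffineBasis.combo_add_radius_mem {P Q u : Plane} (hP : ∀ i, 0 < b.coord i P)
    (hQ : ∀ i, 0 < b.coord i Q) (hu : u ≠ 0) {s t : ℝ} (hs : 0 ≤ s) (ht : 0 ≤ t)
    (hst : s + t = 1) :
    (s • P + t • Q) + (s * b.radius P u + t * b.radius Q u) • u ∈ convexHull ℝ (range b) := by
  have h1 := (add_smul_mem_iff hP hu (radius_pos hP hu)).2 le_rfl
  have h2 := (add_smul_mem_iff hQ hu (radius_pos hQ hu)).2 le_rfl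
  convert convex_convexHull ℝ (range b) h1 h2 hs ht hst using 1
  module

theorem AffineBasis.combo_radius_le {P Q u : Plane} (hP : ∀ i, 0 < b.coord i P)
    (hQ : ∀ i, 0 < b.coord i Q) (hu : u ≠ 0) {s t : ℝ} (hs : 0 < s) (ht : 0 < t)
    (hst : s + t = 1) :
    s * b.radius P u + t * b.radius Q u ≤ b.radius (s • P + t • Q) u := by
  have h1 := radius_pos hP hu
  have h2 := radius_pos hQ hu
  exact (add_smul_mem_iff (combo_coord_pos hP hQ hs ht hst) hu (by positivity)).1
    (combo_add_radius_mem hP hQ hu hs.le ht.le hst)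

/-- Equality in the concavity of the radius in the direction of the vertex `b k` forces the
other coordinates to be proportional. -/
theorem AffineBasis.coord_proportional {P Q : Plane} (hP : ∀ i, 0 < b.coord i P)
    (hQ : ∀ i, 0 < b.coord i Q) {s t : ℝ} (hs : 0 < s) (ht : 0 < t)
    (hst : s + t = 1) {k : ι} {c : ℝ} (hc : 0 < c)
    (hu : b k - (s • P + t • Q) ≠ 0)
    (heq : s * b.radius P (c • (b k - (s • P + t • Q))) +
        t * b.radius Q (c • (b k - (s • P + t • Q))) =
      b.radius (s • P + t • Q) (c • (b k - (s • P + t • Q)))) :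
    ∃ d : ℝ, ∀ i, i ≠ k → b.coord i P = d * b.coord i (s • P + t • Q) := by
  set M := s • P + t • Q with hMdef
  set u := c • (b k - M) with hudef
  have hu0 : u ≠ 0 := smul_ne_zero hc.ne' hu
  have hM : ∀ i, 0 < b.coord i M := combo_coord_pos hP hQ hs ht hst
  have hlin : ∀ i, i ≠ k → (b.coord i).linear u = -(c * b.coord i M) := by
    intro i hi
    have h1 := b.coord_add_smul i M (b k - M) 1
    have h2 : b.coord i (b k) = 0 := b.coord_apply_ne hi
    rw [one_smul, add_sub_cancel, h2] at h1
    rw [hudef, map_smul, smul_eq_mul]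
    linear_combination (-c) * h1
  have hreach : c⁻¹ ≤ b.radius M u := by
    refine (add_smul_mem_iff hM hu0 (inv_pos.2 hc)).1 ?_
    rw [hudef, smul_smul, inv_mul_cancel₀ hc.ne', one_smul, add_sub_cancel]
    exact subset_convexHull ℝ _ (mem_range_self k)
  have hXP := (add_smul_mem_iff hP hu0 (radius_pos hP hu0)).2 le_rfl
  have hXQ := (add_smul_mem_iff hQ hu0 (radius_pos hQ hu0)).2 le_rfl
  rw [b.convexHull_eq_nonneg_coord] at hXP hXQ
  refine ⟨c * b.radius P u, fun i hi => ?_⟩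
  have h1 := hXP i
  have h2 := hXQ i
  rw [b.coord_add_smul, hlin i hi] at h1 h2
  have hMi : b.coord i M = s * b.coord i P + t * b.coord i Q := b.coord_combo i P Q hst
  have h3 : 1 ≤ c * (s * b.radius P u + t * b.radius Q u) := by
    rw [heq]
    calc 1 = c * c⁻¹ := (mul_inv_cancel₀ hc.ne').symm
      _ ≤ _ := by gcongr
  have h4 := mul_le_mul_of_nonneg_right h3 (hM i).le
  have h5 := mul_nonneg ht.le h2
  have h6 : s * (b.coord i P + b.radius P u * -(c * b.coord i M)) ≤ 0 := by linarith
  have h7 := nonpos_of_mul_nonpos_right h6 hs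
  linarith

theorem AffineBasis.exists_combo_radius_lt (hι : 3 ≤ Fintype.card ι) {P Q : Plane}
    (hP : ∀ i, 0 < b.coord i P) (hQ : ∀ i, 0 < b.coord i Q) (hPQ : P ≠ Q) {s t : ℝ}
    (hs : 0 < s) (ht : 0 < t) (hst : s + t = 1) :
    ∃ u : sphere (0 : Plane) 1,
      s * b.radius P u + t * b.radius Q u < b.radius (s • P + t • Q) u := by
  classical
  by_contra! hcon
  set M := s • P + t • Q with hMdef
  have hM : ∀ i, 0 < b.coord i M := combo_coord_pos hP hQ hs ht hst
  have hprop : ∀ k, ∃ d : ℝ, ∀ i, i ≠ k → b.coord i P = d * b.coord i M := by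
    intro k
    have hne : b k - M ≠ 0 := by
      obtain ⟨j, hj⟩ : ∃ j, j ≠ k := Fintype.exists_ne_of_one_lt_card (by omega) k
      intro h
      have := hM j
      rw [← sub_eq_zero.1 h, b.coord_apply_ne hj] at this
      exact this.false
    have hn : 0 < ‖b k - M‖⁻¹ := inv_pos.2 (norm_pos_iff.2 hne)
    have hmem : ‖b k - M‖⁻¹ • (b k - M) ∈ sphere (0 : Plane) 1 := by
      rw [mem_sphere_zero_iff_norm, norm_smul, norm_inv, norm_norm,
        inv_mul_cancel₀ (norm_ne_zero_iff.2 hne)]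
    exact coord_proportional hP hQ hs ht hst hn hne
      (le_antisymm (combo_radius_le hP hQ (ne_zero_of_mem_unit_sphere ⟨_, hmem⟩) hs ht hst)
        (hcon ⟨_, hmem⟩))
  have hcross : ∀ i j, b.coord i P * b.coord j M = b.coord j P * b.coord i M := by
    intro i j
    obtain ⟨k, hk⟩ : ∃ k, k ∉ ({i, j} : Finset ι) := by
      by_contra! h
      have h1 : Fintype.card ι ≤ ({i, j} : Finset ι).card :=
        Finset.card_le_card (s := Finset.univ) fun x _ => h x
      have h2 : ({i, j} : Finset ι).card ≤ 2 := Finset.card_le_two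
      omega
    simp only [Finset.mem_insert, Finset.mem_singleton, not_or] at hk
    obtain ⟨d, hd⟩ := hprop k
    rw [hd i (Ne.symm hk.1), hd j (Ne.symm hk.2)]
    ring
  have hPM : P = M := by
    refine b.ext_elem fun i => ?_
    have h := Finset.sum_congr rfl fun j (_ : j ∈ Finset.univ) => hcross i j
    rw [← Finset.mul_sum, ← Finset.sum_mul, b.sum_coord_apply_eq_one, b.sum_coord_apply_eq_one]
      at h
    linarith
  refine hPQ (smul_right_injective Plane ht.ne' ?_)
  have : s • P + t • P = s • P + t • Q := by rw [← add_smul, hst, one_smul]; exact hPM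
  exact add_left_cancel this

theorem AffineBasis.strictConcaveOn_coulombPotential (hι : 3 ≤ Fintype.card ι) :
    StrictConcaveOn ℝ (interior (convexHull ℝ (range b)))
      (coulombPotential (convexHull ℝ (range b))) := by
  refine ⟨(convex_convexHull ℝ _).interior, fun P hP Q hQ hPQ s t hs ht hst => ?_⟩
  rw [b.interior_convexHull] at hP hQ
  have hM := combo_coord_pos hP hQ hs ht hst
  rw [coulombPotential_eq hP, coulombPotential_eq hQ, coulombPotential_eq hM, smul_eq_mul,
    smul_eq_mul, ← integral_const_mul, ← integral_const_mul]
  have hInt : ∀ {X : Plane}, (∀ i, 0 < b.coord i X) → Integrable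
      (fun u : sphere (0 : Plane) 1 => b.radius X u) (volume : Measure Plane).toSphere :=
    fun hX => (continuous_radius hX).integrable_of_hasCompactSupport
      (HasCompactSupport.of_compactSpace _)
  have hsum : Integrable (fun u : sphere (0 : Plane) 1 => s * b.radius P u + t * b.radius Q u)
      (volume : Measure Plane).toSphere := ((hInt hP).const_mul s).add ((hInt hQ).const_mul t)
  rw [← integral_add ((hInt hP).const_mul s) ((hInt hQ).const_mul t), ← sub_pos,
    ← integral_sub (hInt hM) hsum]
  obtain ⟨u, hu⟩ := exists_combo_radius_lt hι hP hQ hPQ hs ht hst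
  have := continuous_radius hP
  have := continuous_radius hQ
  have := continuous_radius hM
  refine Continuous.integral_pos_of_hasCompactSupport_nonneg_nonzero (x := u) (by fun_prop)
    (HasCompactSupport.of_compactSpace _) (fun v => ?_) (sub_pos.2 hu).ne'
  exact sub_nonneg.2 (combo_radius_le hP hQ (ne_zero_of_mem_unit_sphere v) hs ht hst)

end Concavity

section Boundary

open Set Metric Topology

theorem coulombPotential_image_homothety {K : Set Plane} (hK : MeasurableSet K) (P v : Plane)
    {c : ℝ} (hc : 0 < c) :
    coulombPotential ((fun X => c • X + v) '' K) (c • P + v) = c * coulombPotential K P := by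
  have hd : ∀ X ∈ K, HasFDerivWithinAt (fun X : Plane => c • X + v)
      (c • ContinuousLinearMap.id ℝ Plane) K X := fun X _ =>
    (((hasFDerivAt_id X).const_smul c).add_const v).hasFDerivWithinAt
  have hinj : InjOn (fun X : Plane => c • X + v) K := fun X _ Y _ h =>
    smul_right_injective Plane hc.ne' (add_right_cancel h)
  rw [coulombPotential, integral_image_eq_integral_abs_det_fderiv_smul volume hK hd hinj,
    coulombPotential, ← integral_const_mul]
  congr 1 with X
  have hdet : (c • ContinuousLinearMap.id ℝ Plane).det = c ^ 2 := by
    simp [ContinuousLinearMap.det]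
  rw [hdet, dist_add_right, dist_smul₀, Real.norm_eq_abs, abs_of_pos hc,
    abs_of_pos (by positivity), smul_eq_mul, mul_inv, ← mul_assoc]
  congr 1
  field_simp

/-- A boundary point lying on a segment of the boundary does not maximize the potential:
the inward derivative of the potential diverges logarithmically there. -/
theorem exists_coulombPotential_lt_of_boundary_segment {K : Set Plane} (hK : IsCompact K)
    (hc : Convex ℝ K) {P e M : Plane} (hP : P ∈ K) (he : e ∈ K) (heP : e ≠ P)
    (hM : M ∈ interior K) (g : Plane →L[ℝ] ℝ) (hg : ∀ X ∈ K, g P ≤ g X) (hge : g e = g P)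
    (hgM : g P < g M) :
    ∃ Q, coulombPotential K P < coulombPotential K Q := by
  set d := e - P with hd
  have hd0 : 0 < ‖d‖ := norm_pos_iff.2 (sub_ne_zero.2 heP)
  set N := (1 / 2 : ℝ) • P + (1 / 2 : ℝ) • M with hN
  have hNK : N ∈ interior K :=
    hc.combo_self_interior_mem_interior hP hM (by norm_num) (by norm_num) (by norm_num)
  have hNM : g N < g M := by
    simp only [hN, map_add, map_smul, smul_eq_mul]
    linarith
  obtain ⟨ρ₀, hρ₀, hball₀⟩ := Metric.isOpen_iff.1
    (isOpen_interior.inter (isOpen_Iio.preimage g.continuous)) N ⟨hNK, hNM⟩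
  obtain ⟨ρ, hρ, hρd, hball⟩ : ∃ ρ, 0 < ρ ∧ 2 * ρ ≤ ‖d‖ ∧ ∀ Z ∈ ball N ρ, Z ∈ K ∧ g Z < g M := by
    refine ⟨min ρ₀ (‖d‖ / 2), by positivity, by linarith [min_le_right ρ₀ (‖d‖ / 2)], fun Z hZ => ?_⟩
    have := hball₀ (ball_subset_ball (min_le_left _ _) hZ)
    exact ⟨interior_subset this.1, this.2⟩
  set C := ‖M - N‖ + ρ with hC
  have hC0 : 0 < C := by positivity
  set v := volume.real (ball (0 : Plane) ρ) with hv
  have hv0 : 0 < v := ENNReal.toReal_pos (measure_ball_pos _ _ hρ).ne' measure_ball_lt_top.ne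
  obtain ⟨n, hn⟩ : ∃ n : ℕ, coulombPotential K P * ((‖d‖ + C) / v) <
      ∑ j ∈ Finset.range n, 1 / ((j : ℝ) + 1) :=
    (Real.tendsto_sum_range_one_div_nat_succ_atTop.eventually_gt_atTop _).exists
  set t : ℝ := 1 / ((n : ℝ) + 1) with ht
  have ht0 : 0 < t := by positivity
  have htn : t * (n + 1) = 1 := by rw [ht]; field_simp
  have hV0 : 0 ≤ coulombPotential K P := integral_nonneg fun _ => by positivity
  have hn0 : n ≠ 0 := by
    rintro rfl
    simp only [Finset.range_zero, Finset.sum_empty] at hn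
    have : 0 ≤ coulombPotential K P * ((‖d‖ + C) / v) := by positivity
    linarith
  have ht1 : t < 1 := by
    have : (1 : ℝ) ≤ n := by exact_mod_cast Nat.one_le_iff_ne_zero.2 hn0
    nlinarith
  set Pt := (1 - t) • P + t • M with hPt
  set Kt := (fun X => (1 - t) • X + t • M) '' K with hKt
  let B : ℕ → Set Plane := fun j => ball (P + t • ((j : ℝ) • d + (N - P))) (t * ρ)
  have hBprop : ∀ j ∈ Finset.range n, ∀ X ∈ B j,
      X ∈ K ∧ g X < (1 - t) * g P + t * g M ∧ dist Pt X ≤ t * (j * ‖d‖ + C) := by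
    intro j hj X hX
    set Z := P + t⁻¹ • (X - P) - (j : ℝ) • d with hZ
    have hXZ : X = (1 - t * j - t) • P + (t * j) • e + t • Z := by
      have : t • t⁻¹ • (X - P) = X - P := smul_inv_smul₀ ht0.ne' _
      rw [hZ, smul_sub, smul_add, this, hd]
      module
    have hZN : Z ∈ ball N ρ := by
      have h1 : X - (P + t • ((j : ℝ) • d + (N - P))) = t • (Z - N) := by
        rw [hXZ, hd]; module
      have h2 : dist X (P + t • ((j : ℝ) • d + (N - P))) < t * ρ := hX
      rw [dist_eq_norm, h1, norm_smul, Real.norm_eq_abs, abs_of_pos ht0] at h2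
      rw [mem_ball, dist_eq_norm]
      exact lt_of_mul_lt_mul_left h2 ht0.le
    obtain ⟨hZK, hZg⟩ := hball Z hZN
    have hjn : (j : ℝ) + 1 ≤ n := by exact_mod_cast Finset.mem_range.1 hj
    have hcoef : 0 ≤ 1 - t * j - t := by nlinarith
    refine ⟨?_, ?_, ?_⟩
    · have := hc.sum_mem (t := Finset.univ) (w := ![1 - t * j - t, t * j, t]) (z := ![P, e, Z])
        (fun i _ => by fin_cases i <;> simp <;> first | linarith | positivity)
        (by simp [Fin.sum_univ_three]; ring) (fun i _ => by fin_cases i <;> simpa)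
      rw [hXZ]
      simpa [Fin.sum_univ_three] using this
    · rw [hXZ]
      simp only [map_add, map_smul, smul_eq_mul, hge]
      nlinarith
    · have h1 : Pt - X = t • ((M - N) - (Z - N) - (j : ℝ) • d) := by
        rw [hXZ, hPt, hd]; module
      rw [dist_eq_norm, h1, norm_smul, Real.norm_eq_abs, abs_of_pos ht0]
      have h2 : ‖Z - N‖ < ρ := by rwa [mem_ball, dist_eq_norm] at hZN
      have h3 : ‖(j : ℝ) • d‖ = j * ‖d‖ := by simp [norm_smul]
      have h4 := norm_sub_le (M - N - (Z - N)) ((j : ℝ) • d)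
      have h5 := norm_sub_le (M - N) (Z - N)
      gcongr
      linarith
  have hKtK : Kt ⊆ K := by
    rintro _ ⟨X, hX, rfl⟩
    exact hc hX (interior_subset hM) (by linarith) ht0.le (by ring)
  have hdisj : Disjoint Kt (⋃ j ∈ Finset.range n, B j) := by
    rw [Set.disjoint_left]
    rintro _ ⟨X, hX, rfl⟩ hXB
    obtain ⟨j, hj, hXj⟩ := mem_iUnion₂.1 hXB
    have h1 := (hBprop j hj _ hXj).2.1
    have h2 := hg X hX
    simp only [map_add, map_smul, smul_eq_mul] at h1
    nlinarith
  have hpair : (↑(Finset.range n) : Set ℕ).Pairwise (Function.onFun Disjoint B) := by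
    intro i _ j _ hij
    refine ball_disjoint_ball ?_
    have h1 : P + t • ((i : ℝ) • d + (N - P)) - (P + t • ((j : ℝ) • d + (N - P))) =
        (t * ((i : ℝ) - j)) • d := by module
    rw [dist_eq_norm, h1, norm_smul, Real.norm_eq_abs, abs_mul, abs_of_pos ht0]
    have h2 : (1 : ℝ) ≤ |(i : ℝ) - j| := by
      have : (1 : ℤ) ≤ |(i : ℤ) - j| := Int.one_le_abs (by omega)
      exact_mod_cast this
    nlinarith [mul_le_mul_of_nonneg_right h2 hd0.le]
  have hInt := integrableOn_inv_dist hK.isBounded Pt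
  have hBK : (⋃ j ∈ Finset.range n, B j) ⊆ K := iUnion₂_subset fun j hj X hX => (hBprop j hj X hX).1
  have hmB : MeasurableSet (⋃ j ∈ Finset.range n, B j) :=
    Finset.measurableSet_biUnion _ fun _ _ => measurableSet_ball
  have hsplit : coulombPotential Kt Pt + ∑ j ∈ Finset.range n, ∫ X in B j, (dist Pt X)⁻¹ ≤
      coulombPotential K Pt := by
    rw [← integral_biUnion_finset _ (fun _ _ => measurableSet_ball) hpair
        (fun j hj => hInt.mono_set fun X hX => (hBprop j hj X hX).1), coulombPotential,
      ← setIntegral_union hdisj hmB (hInt.mono_set hKtK) (hInt.mono_set hBK)]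
    exact setIntegral_mono_set hInt (.of_forall fun _ => by positivity)
      (union_subset hKtK hBK).eventuallyLE
  have hKtV : coulombPotential Kt Pt = (1 - t) * coulombPotential K P :=
    coulombPotential_image_homothety hK.measurableSet P (t • M) (by linarith)
  have hBint : ∀ j ∈ Finset.range n,
      t * (v / (‖d‖ + C)) * (1 / ((j : ℝ) + 1)) ≤ ∫ X in B j, (dist Pt X)⁻¹ := by
    intro j hj
    have hcenter : Pt ∉ B j := by
      intro h
      have := (hBprop j hj Pt h).2.1
      simp only [hPt, map_add, map_smul, smul_eq_mul] at this
      exact this.false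
    have hle : ∀ X ∈ B j, (t * (j * ‖d‖ + C))⁻¹ ≤ (dist Pt X)⁻¹ := fun X hX =>
      inv_anti₀ (dist_pos.2 fun h => hcenter (h ▸ hX)) (hBprop j hj X hX).2.2
    refine le_trans ?_ (setIntegral_ge_of_const_le_real measurableSet_ball
      measure_ball_lt_top.ne hle (hInt.mono_set fun X hX => (hBprop j hj X hX).1))
    have hvol : volume.real (B j) = t ^ 2 * v := by
      simp only [B, Measure.real, hv]
      rw [Measure.addHaar_ball_mul _ _ ht0.le, ENNReal.toReal_mul,
        ENNReal.toReal_ofReal (by positivity)]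
      simp
    rw [hvol]
    have hj0 : (0 : ℝ) ≤ j := j.cast_nonneg
    have h1 : j * ‖d‖ + C ≤ (‖d‖ + C) * (j + 1) := by nlinarith
    have h2 : 0 < j * ‖d‖ + C := by positivity
    calc t * (v / (‖d‖ + C)) * (1 / ((j : ℝ) + 1))
        = t * v / ((‖d‖ + C) * (j + 1)) := by field_simp
      _ ≤ t * v / (j * ‖d‖ + C) := by gcongr
      _ = (t * (j * ‖d‖ + C))⁻¹ * (t ^ 2 * v) := by field_simp
  refine ⟨Pt, ?_⟩
  have hsum := Finset.sum_le_sum hBint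
  rw [← Finset.mul_sum] at hsum
  have hgain : t * coulombPotential K P <
      t * (v / (‖d‖ + C)) * ∑ j ∈ Finset.range n, 1 / ((j : ℝ) + 1) := by
    have h1 : 0 < t * (v / (‖d‖ + C)) := by positivity
    have h2 := mul_lt_mul_of_pos_left hn h1
    calc t * coulombPotential K P
        = t * (v / (‖d‖ + C)) * (coulombPotential K P * ((‖d‖ + C) / v)) := by field_simp
      _ < _ := h2
  linarith

end Boundary

section Uniqueness

open Set Metric Topology Filter

theorem ConcaveOn.le_of_hasFDerivAt_zero {E : Type*} [NormedAddCommGroup E] [NormedSpace ℝ E]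
    {s : Set E} {f : E → ℝ} (hf : ConcaveOn ℝ s f) {P Q : E} (hP : P ∈ s) (hQ : Q ∈ s)
    (h : HasFDerivAt f (0 : E →L[ℝ] ℝ) P) : f Q ≤ f P := by
  have hline : HasDerivAt (fun t : ℝ => f (P + t • (Q - P))) 0 0 := by
    have h1 : HasDerivAt (fun t : ℝ => P + t • (Q - P)) (Q - P) 0 := by
      simpa using ((hasDerivAt_id (0 : ℝ)).smul_const (Q - P)).const_add P
    have h2 : HasFDerivAt f (0 : E →L[ℝ] ℝ) (P + (0 : ℝ) • (Q - P)) := by simpa using h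
    simpa [Function.comp_def] using h2.comp_hasDerivAt (0 : ℝ) h1
  have hslope := hline.tendsto_slope_zero_right
  suffices f Q - f P ≤ 0 by linarith
  refine ge_of_tendsto hslope ?_
  filter_upwards [Ioc_mem_nhdsGT (zero_lt_one' ℝ)] with t ht
  have hconc := hf.2 hP hQ (sub_nonneg.2 ht.2) ht.1.le (by ring)
  have heq : (1 - t) • P + t • Q = P + t • (Q - P) := by module
  rw [heq, smul_eq_mul, smul_eq_mul] at hconc
  simp only [zero_add, zero_smul, add_zero, smul_eq_mul]
  rw [le_inv_mul_iff₀ ht.1]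
  linarith

variable {ι : Type*} [Fintype ι] (b : AffineBasis ι ℝ Plane)

theorem AffineBasis.mem_interior_of_isMax_coulombPotential (hι : 3 ≤ Fintype.card ι) {P : Plane}
    (hmax : ∀ Q, coulombPotential (convexHull ℝ (range b)) Q ≤
      coulombPotential (convexHull ℝ (range b)) P) :
    P ∈ interior (convexHull ℝ (range b)) := by
  classical
  have hK := b.isCompact_convexHull
  have hc := convex_convexHull ℝ (range b)
  have hM := b.centroid_mem_interior_convexHull
  have hPK : P ∈ convexHull ℝ (range b) := by
    by_contra hP
    obtain ⟨Q, -, hQ⟩ := exists_mem_coulombPotential_lt hK hc ⟨_, hM⟩ hP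
    exact hQ.not_ge (hmax Q)
  by_contra hPi
  rw [b.interior_convexHull] at hPi
  have hnonneg : ∀ X ∈ convexHull ℝ (range b), ∀ i, 0 ≤ b.coord i X := by
    intro X hX
    rwa [b.convexHull_eq_nonneg_coord] at hX
  obtain ⟨i, hi⟩ : ∃ i, b.coord i P ≤ 0 := by simpa using hPi
  have hi0 : b.coord i P = 0 := hi.antisymm (hnonneg P hPK i)
  obtain ⟨j, hji, hjP⟩ : ∃ j, j ≠ i ∧ b j ≠ P := by
    by_contra! h
    have hsub : Finset.univ ⊆ insert i (Finset.univ.filter fun j => b j = P) := by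
      intro j _
      by_cases hj : j = i <;> simp [hj, h j]
    have h1 : (Finset.univ.filter fun j => b j = P).card ≤ 1 :=
      Finset.card_le_one.2 fun x hx y hy => b.ind.injective <| by simp_all
    have h2 := (Finset.card_le_card hsub).trans (Finset.card_insert_le _ _)
    rw [Finset.card_univ] at h2
    omega
  have hlin : ∀ X, (b.coord i).linear X = b.coord i X - b.coord i 0 := by
    intro X
    have := b.coord_add_smul i 0 X 1
    simp only [zero_add, one_smul, one_mul] at this
    linarith
  have hbj : b.coord i (b j) = 0 := b.coord_apply_ne hji.symm
  obtain ⟨Q, hQ⟩ := exists_coulombPotential_lt_of_boundary_segment hK hc hPK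
    (subset_convexHull ℝ _ (mem_range_self j)) hjP hM (b.coord i).linear.toContinuousLinearMap
    (fun X hX => by
      have := hnonneg X hX i
      simp only [LinearMap.coe_toContinuousLinearMap', hlin]
      linarith)
    (by simp only [LinearMap.coe_toContinuousLinearMap', hlin, hbj, hi0])
    (by
      rw [b.interior_convexHull] at hM
      have := hM i
      simp only [LinearMap.coe_toContinuousLinearMap', hlin]
      linarith)
  exact hQ.not_ge (hmax Q)

theorem exists_isMax_coulombPotential {K : Set Plane} (hK : IsCompact K) (hc : Convex ℝ K)
    (hi : (interior K).Nonempty) :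
    ∃ P, ∀ Q, coulombPotential K Q ≤ coulombPotential K P := by
  obtain ⟨P, -, hP⟩ := hK.exists_isMaxOn (hi.mono interior_subset)
    (continuous_coulombPotential hK hc).continuousOn
  refine ⟨P, fun Q => ?_⟩
  by_cases hQ : Q ∈ K
  · exact hP hQ
  · obtain ⟨R, hR, hQR⟩ := exists_mem_coulombPotential_lt hK hc hi hQ
    exact hQR.le.trans (hP hR)

variable [Nonempty ι]

theorem AffineBasis.isMax_coulombPotential_iff (hι : 3 ≤ Fintype.card ι) {P : Plane} :
    (∀ Q, coulombPotential (convexHull ℝ (range b)) Q ≤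
      coulombPotential (convexHull ℝ (range b)) P) ↔
    P ∈ interior (convexHull ℝ (range b)) ∧
      gradient (coulombPotential (convexHull ℝ (range b))) P = 0 := by
  constructor
  · intro hmax
    refine ⟨b.mem_interior_of_isMax_coulombPotential hι hmax, ?_⟩
    have h : IsLocalMax (coulombPotential (convexHull ℝ (range b))) P :=
      Filter.Eventually.of_forall hmax
    rw [gradient, h.fderiv_eq_zero, map_zero]
  · rintro ⟨hP, hgrad⟩ Q
    have hK := b.isCompact_convexHull
    obtain ⟨M, hM⟩ := exists_isMax_coulombPotential hK (convex_convexHull ℝ (range b)) ⟨P, hP⟩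
    have hd := (differentiableAt_coulombPotential hK hP).hasGradientAt
    rw [hgrad, hasGradientAt_iff_hasFDerivAt, map_zero] at hd
    exact (hM Q).trans <| (b.strictConcaveOn_coulombPotential hι).concaveOn.le_of_hasFDerivAt_zero
      hP (b.mem_interior_of_isMax_coulombPotential hι hM) hd

theorem AffineBasis.existsUnique_isMax_coulombPotential (hι : 3 ≤ Fintype.card ι) :
    ∃! P, ∀ Q, coulombPotential (convexHull ℝ (range b)) Q ≤
      coulombPotential (convexHull ℝ (range b)) P := by
  obtain ⟨P, hP⟩ := exists_isMax_coulombPotential b.isCompact_convexHull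
    (convex_convexHull ℝ (range b)) ⟨_, b.centroid_mem_interior_convexHull⟩
  refine ⟨P, hP, fun Q hQ => ?_⟩
  exact (b.strictConcaveOn_coulombPotential hι).eq_of_isMaxOn (fun X _ => hQ X) (fun X _ => hP X)
    (b.mem_interior_of_isMax_coulombPotential hι hQ)
    (b.mem_interior_of_isMax_coulombPotential hι hP)

end Uniqueness

theorem electrostatic_center_unique
    (A B C : EuclideanSpace ℝ (Fin 2))
    (hABC : AffineIndependent ℝ ![A, B, C])
    (T : Set (EuclideanSpace ℝ (Fin 2)))
    (hT : T = convexHull ℝ {A, B, C})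
    (V : EuclideanSpace ℝ (Fin 2) → ℝ)
    (hV : ∀ P, V P = ∫ Q in T, (dist P Q)⁻¹ ∂volume) :
    (∃! P : EuclideanSpace ℝ (Fin 2), P ∈ interior T ∧ gradient V P = 0) ∧
    (∃! P : EuclideanSpace ℝ (Fin 2), ∀ Q, V Q ≤ V P) ∧
    (∀ P : EuclideanSpace ℝ (Fin 2),
      (P ∈ interior T ∧ gradient V P = 0) → ∀ Q, V Q ≤ V P) := by
  let b : AffineBasis (Fin 3) ℝ Plane :=
    ⟨![A, B, C], hABC, hABC.affineSpan_eq_top_iff_card_eq_finrank_add_one.2 (by simp)⟩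
  have hrange : Set.range b = {A, B, C} := by
    change Set.range ![A, B, C] = _
    simp only [Matrix.range_cons, Matrix.range_empty, Set.union_empty]
    rfl
  have hV' : V = coulombPotential T := funext hV
  subst hV'
  rw [← hrange] at hT
  subst hT
  have hcard : 3 ≤ Fintype.card (Fin 3) := by simp
  have huniq := b.existsUnique_isMax_coulombPotential hcard
  refine ⟨?_, huniq, fun P hP => (b.isMax_coulombPotential_iff hcard).2 hP⟩
  simpa only [b.isMax_coulombPotential_iff hcard] using huniq
end

section
/- Characterization of the illuminating center (case p = −2): let P be a point in the interior of T, let u φ ∈ E be the unit vector with coordinates (cos φ, sin φ), and let R φ = sSup {r : ℝ | 0 ≤ r ∧ P + r • u φ ∈ T}. If ∫ φ in (0)..(2π), (R φ)⁻¹ • (u φ) dφ = 0, then (∠ B P C) / (volume (convexHull ℝ {P, B, C})).toReal = (∠ C P A) / (volume (convexHull ℝ {P, C, A})).toReal = (∠ A P B) / (volume (convexHull ℝ {P, A, B})).toReal. -/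
open MeasureTheory EuclideanGeometry Real

namespace IlluminatingCenter

/-- The Euclidean plane. -/
local notation "E" => EuclideanSpace ℝ (Fin 2)

/-- The unit vector with polar angle `φ`. -/
noncomputable def dir (φ : ℝ) : E := !₂[cos φ, sin φ]

/-- The two-dimensional cross product. -/
def cross (p q : E) : ℝ := p 0 * q 1 - p 1 * q 0

/-- The vector `N` with `⟪N, p⟫ = ⟪N, q⟫ = 1`, for linearly independent `p` and `q`. -/
noncomputable def polarVec (p q : E) : E :=
  !₂[(q 1 - p 1) / cross p q, (p 0 - q 0) / cross p q]

@[simp] lemma dir_zero (φ : ℝ) : dir φ 0 = cos φ := rfl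

@[simp] lemma dir_one (φ : ℝ) : dir φ 1 = sin φ := rfl

@[simp] lemma polarVec_zero (p q : E) : polarVec p q 0 = (q 1 - p 1) / cross p q := rfl

@[simp] lemma polarVec_one (p q : E) : polarVec p q 1 = (p 0 - q 0) / cross p q := rfl

lemma norm_sq_eq (p : E) : ‖p‖ ^ 2 = p 0 ^ 2 + p 1 ^ 2 := by
  simp [EuclideanSpace.norm_sq_eq]

lemma inner_eq (p q : E) : inner ℝ p q = p 0 * q 0 + p 1 * q 1 := by
  simp [PiLp.inner_apply, mul_comm]

lemma norm_dir (φ : ℝ) : ‖dir φ‖ = 1 := by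
  have h := norm_sq_eq (dir φ)
  simp only [dir_zero, dir_one, cos_sq_add_sin_sq] at h
  exact (pow_eq_one_iff_of_nonneg (norm_nonneg _) two_ne_zero).1 h

lemma exists_eq_norm_smul_dir (p : E) : ∃ α, p = ‖p‖ • dir α := by
  have hn : ‖(⟨p 0, p 1⟩ : ℂ)‖ = ‖p‖ := by
    rw [← sq_eq_sq₀ (norm_nonneg _) (norm_nonneg _), norm_sq_eq, Complex.sq_norm,
      Complex.normSq_apply]
    ring
  refine ⟨Complex.arg ⟨p 0, p 1⟩, ?_⟩
  ext i
  fin_cases i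
  · have := Complex.norm_mul_cos_arg (⟨p 0, p 1⟩ : ℂ)
    rw [hn] at this
    simpa using this.symm
  · have := Complex.norm_mul_sin_arg (⟨p 0, p 1⟩ : ℂ)
    rw [hn] at this
    simpa using this.symm

lemma norm_pos_of_cross_pos {p q : E} (h : 0 < cross p q) : 0 < ‖p‖ ∧ 0 < ‖q‖ := by
  constructor <;>
  · rw [norm_pos_iff]
    rintro rfl
    simp [cross] at h

lemma norm_mul_sin_angle {p q : E} (h : 0 < cross p q) :
    ‖p‖ * ‖q‖ * sin (InnerProductGeometry.angle p q) = cross p q := by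
  have hs := InnerProductGeometry.sin_angle_nonneg p q
  have hc := InnerProductGeometry.cos_angle_mul_norm_mul_norm p q
  rw [← sq_eq_sq₀ (by positivity) h.le]
  rw [inner_eq] at hc
  have h1 := sin_sq_add_cos_sq (InnerProductGeometry.angle p q)
  have hp := norm_sq_eq p
  have hq := norm_sq_eq q
  calc _ = ‖p‖ ^ 2 * ‖q‖ ^ 2 * sin (InnerProductGeometry.angle p q) ^ 2 := by ring
    _ = ‖p‖ ^ 2 * ‖q‖ ^ 2
        - (cos (InnerProductGeometry.angle p q) * (‖p‖ * ‖q‖)) ^ 2 := by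
      linear_combination (‖p‖ ^ 2 * ‖q‖ ^ 2) * h1
    _ = cross p q ^ 2 := by
      rw [hc, hp, hq, cross]
      ring

lemma angle_mem_Ioo {p q : E} (h : 0 < cross p q) :
    InnerProductGeometry.angle p q ∈ Set.Ioo 0 π := by
  have hs := norm_mul_sin_angle h
  refine ⟨(InnerProductGeometry.angle_nonneg p q).lt_of_ne ?_,
    (InnerProductGeometry.angle_le_pi p q).lt_of_ne ?_⟩
  · intro h0
    rw [← h0] at hs
    simp at hs
    exact h.ne hs
  · intro h0
    rw [h0] at hs
    simp at hs
    exact h.ne hs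

lemma eq_norm_smul_dir_add_angle {p q : E} (h : 0 < cross p q) {α : ℝ}
    (hp : p = ‖p‖ • dir α) :
    q = ‖q‖ • dir (α + InnerProductGeometry.angle p q) := by
  obtain ⟨hp0, -⟩ := norm_pos_of_cross_pos h
  have hs := norm_mul_sin_angle h
  have hc := InnerProductGeometry.cos_angle_mul_norm_mul_norm p q
  rw [inner_eq] at hc
  rw [cross] at hs
  have e0 : p 0 = ‖p‖ * cos α := by simpa using congrArg (fun x : E => x 0) hp
  have e1 : p 1 = ‖p‖ * sin α := by simpa using congrArg (fun x : E => x 1) hp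
  rw [e0, e1] at hs hc
  have h1 := sin_sq_add_cos_sq α
  ext i
  fin_cases i
  · simp only [Fin.zero_eta, PiLp.smul_apply, dir_zero, smul_eq_mul, cos_add]
    apply mul_left_cancel₀ hp0.ne'
    linear_combination sin α * hs - cos α * hc - ‖p‖ * q 0 * h1
  · simp only [Fin.mk_one, PiLp.smul_apply, dir_one, smul_eq_mul, sin_add]
    apply mul_left_cancel₀ hp0.ne'
    linear_combination - cos α * hs - sin α * hc - ‖p‖ * q 1 * h1

/-- The three angles around an interior point add up to a full turn. -/
lemma angle_add_angle_add_angle {a b c : E} (hab : 0 < cross a b) (hbc : 0 < cross b c)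
    (hca : 0 < cross c a) :
    InnerProductGeometry.angle a b + InnerProductGeometry.angle b c
      + InnerProductGeometry.angle c a = 2 * π := by
  obtain ⟨α, hα⟩ := exists_eq_norm_smul_dir a
  have hb := eq_norm_smul_dir_add_angle hab hα
  have hc := eq_norm_smul_dir_add_angle hbc hb
  have ha := eq_norm_smul_dir_add_angle hca hc
  have h1 := angle_mem_Ioo hab
  have h2 := angle_mem_Ioo hbc
  have h3 := angle_mem_Ioo hca
  set x := InnerProductGeometry.angle a b
  set y := InnerProductGeometry.angle b c
  set z := InnerProductGeometry.angle c a
  have hd : dir (α + x + y + z) = dir α :=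
    smul_right_injective E (norm_pos_of_cross_pos hab).1.ne' (ha.symm.trans hα)
  have hcos : cos (α + x + y + z) = cos α := congrArg (fun v : E => v 0) hd
  have hsin : sin (α + x + y + z) = sin α := congrArg (fun v : E => v 1) hd
  have hone : cos (x + y + z) = 1 := by
    have : x + y + z = (α + x + y + z) - α := by ring
    rw [this, cos_sub, hcos, hsin]
    linear_combination sin_sq_add_cos_sq α
  obtain ⟨n, hn⟩ := (cos_eq_one_iff _).1 hone
  have hpi := pi_pos
  have hn0 : 0 < n := by
    by_contra! hle
    have : (n : ℝ) ≤ 0 := by exact_mod_cast hle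
    nlinarith [h1.1, h2.1, h3.1]
  have hn2 : n < 2 := by
    by_contra! hle
    have : (2 : ℝ) ≤ n := by exact_mod_cast hle
    nlinarith [h1.2, h2.2, h3.2]
  obtain rfl : n = 1 := by omega
  rw [← hn]
  simp

/-- The radial function of a convex set in a direction hitting the edge from `P + p` to `P + q`. -/
lemma sSup_radial {T : Set E} (hT : Convex ℝ T) {P p q v : E}
    (hp : P + p ∈ T) (hq : P + q ∈ T) (hpq : 0 < cross p q)
    (hle : ∀ x ∈ T, cross p (x - P) + cross (x - P) q ≤ cross p q)
    {s t : ℝ} (hs : 0 ≤ s) (ht : 0 ≤ t) (hst : 0 < s + t) (hv : v = s • p + t • q) :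
    sSup {r : ℝ | 0 ≤ r ∧ P + r • v ∈ T} = (s + t)⁻¹ := by
  apply IsGreatest.csSup_eq
  refine ⟨⟨by positivity, ?_⟩, ?_⟩
  · have : P + (s + t)⁻¹ • v = (s / (s + t)) • (P + p) + (t / (s + t)) • (P + q) := by
      rw [hv]
      ext i
      simp
      field_simp
      ring
    rw [this]
    exact hT hp hq (by positivity) (by positivity) (by field_simp)
  · rintro r ⟨-, hr⟩
    have h := hle _ hr
    have e : cross p (P + r • v - P) + cross (P + r • v - P) q = r * (s + t) * cross p q := by
      rw [hv]
      simp [cross]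
      ring
    rw [e] at h
    rw [← one_div, le_div_iff₀ hst]
    exact le_of_mul_le_mul_right (by linarith) hpq

lemma hasDerivAt_dir (φ : ℝ) : HasDerivAt dir (dir (φ + π / 2)) φ := by
  have h : dir = fun φ => cos φ • dir 0 + sin φ • dir (π / 2) := by
    funext φ
    ext i
    fin_cases i <;> simp
  rw [h]
  refine (((hasDerivAt_cos φ).smul_const (dir 0)).add
    ((hasDerivAt_sin φ).smul_const (dir (π / 2)))).congr_deriv ?_
  ext i
  fin_cases i <;> simp [cos_add_pi_div_two, sin_add_pi_div_two]

lemma continuous_dir : Continuous dir :=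
  continuous_iff_continuousAt.2 fun φ => (hasDerivAt_dir φ).continuousAt

lemma continuous_inner_smul_dir (N : E) : Continuous fun φ => inner ℝ N (dir φ) • dir φ :=
  Continuous.smul (f := fun φ => inner ℝ N (dir φ)) (continuous_const.inner continuous_dir)
    continuous_dir

lemma integral_inner_smul_dir (N : E) (α β : ℝ) :
    ∫ φ in α..β, inner ℝ N (dir φ) • dir φ =
      (2⁻¹ : ℝ) • ((β - α) • N - (inner ℝ N (dir β) • dir (β + π / 2)
        - inner ℝ N (dir α) • dir (α + π / 2))) := by
  have hd (φ : ℝ) : HasDerivAt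
      (fun φ => (2⁻¹ : ℝ) • (φ • N - inner ℝ N (dir φ) • dir (φ + π / 2)))
      (inner ℝ N (dir φ) • dir φ) φ := by
    have h1 : HasDerivAt (fun φ => inner ℝ N (dir φ)) (inner ℝ N (dir (φ + π / 2))) φ := by
      simpa using (hasDerivAt_const φ N).inner ℝ (hasDerivAt_dir φ)
    have h2 : HasDerivAt (fun φ => dir (φ + π / 2)) (dir (φ + π / 2 + π / 2)) φ :=
      (hasDerivAt_dir (φ + π / 2)).comp_add_const φ (π / 2)
    refine ((((hasDerivAt_id φ).smul_const N).sub (h1.smul h2)).const_smul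
      (2⁻¹ : ℝ)).congr_deriv ?_
    have h3 := sin_sq_add_cos_sq φ
    ext i
    fin_cases i
    · simp [inner_eq, cos_add_pi_div_two, sin_add_pi_div_two]
      linear_combination (-N 0 / 2) * h3
    · simp [inner_eq, cos_add_pi_div_two, sin_add_pi_div_two]
      linear_combination (-N 1 / 2) * h3
  rw [intervalIntegral.integral_eq_sub_of_hasDerivAt (fun φ _ => hd φ)
    ((continuous_inner_smul_dir N).intervalIntegrable _ _)]
  module

/-- On the angular sector spanned by `p` and `q`, the inverse radial function is linear. -/
lemma inv_radial_eq_inner {T : Set E} (hT : Convex ℝ T) {P p q : E}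
    (hp : P + p ∈ T) (hq : P + q ∈ T) (hpq : 0 < cross p q)
    (hle : ∀ x ∈ T, cross p (x - P) + cross (x - P) q ≤ cross p q)
    {α β : ℝ} (hα : p = ‖p‖ • dir α) (hβ : q = ‖q‖ • dir β) (hβα : β - α < π)
    {φ : ℝ} (hφ : φ ∈ Set.Icc α β) :
    (sSup {r : ℝ | 0 ≤ r ∧ P + r • dir φ ∈ T})⁻¹ = inner ℝ (polarVec p q) (dir φ) := by
  obtain ⟨hp0, hq0⟩ := norm_pos_of_cross_pos hpq
  have hcr : cross p q = ‖p‖ * ‖q‖ * sin (β - α) := by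
    rw [hα, hβ]
    simp only [cross, PiLp.smul_apply, smul_eq_mul, dir_zero, dir_one, norm_smul, norm_norm,
      norm_dir, mul_one, sin_sub]
    ring
  have hsin : 0 < sin (β - α) := by
    rw [hcr] at hpq
    exact pos_of_mul_pos_right hpq (by positivity)
  have hs : 0 ≤ sin (β - φ) :=
    sin_nonneg_of_nonneg_of_le_pi (by linarith [hφ.2]) (by linarith [hφ.1])
  have ht : 0 ≤ sin (φ - α) :=
    sin_nonneg_of_nonneg_of_le_pi (by linarith [hφ.1]) (by linarith [hφ.2])
  have hv : dir φ = (sin (β - φ) / (sin (β - α) * ‖p‖)) • p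
      + (sin (φ - α) / (sin (β - α) * ‖q‖)) • q := by
    have e : sin (β - α) • dir φ = sin (β - φ) • dir α + sin (φ - α) • dir β := by
      ext i
      fin_cases i
      · simp [sin_sub]
        ring
      · simp [sin_sub]
        ring
    apply smul_right_injective E hsin.ne'
    simp only
    have hα' : dir α = ‖p‖⁻¹ • p := (eq_inv_smul_iff₀ hp0.ne').2 hα.symm
    have hβ' : dir β = ‖q‖⁻¹ • q := (eq_inv_smul_iff₀ hq0.ne').2 hβ.symm
    rw [e, hα', hβ', smul_add, smul_smul, smul_smul, smul_smul, smul_smul]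
    congr 2 <;> field_simp
  set s := sin (β - φ) / (sin (β - α) * ‖p‖)
  set t := sin (φ - α) / (sin (β - α) * ‖q‖)
  have hs' : 0 ≤ s := by positivity
  have ht' : 0 ≤ t := by positivity
  have hst : 0 < s + t := by
    refine (add_nonneg hs' ht').lt_of_ne fun h0 => ?_
    have h1 : s = 0 := by linarith
    have h2 : t = 0 := by linarith
    have h3 := norm_dir φ
    rw [hv, h1, h2] at h3
    simp at h3
  rw [sSup_radial hT hp hq hpq hle hs' ht' hst hv, inv_inv, hv, inner_eq]
  simp only [polarVec_zero, polarVec_one, PiLp.add_apply, PiLp.smul_apply, smul_eq_mul]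
  field_simp
  rw [cross]
  ring

lemma inner_polarVec_left {p q : E} (h : 0 < cross p q) {α : ℝ} (hα : p = ‖p‖ • dir α) :
    inner ℝ (polarVec p q) (dir α) = ‖p‖⁻¹ := by
  have hp := (norm_pos_of_cross_pos h).1
  apply mul_left_cancel₀ hp.ne'
  rw [← real_inner_smul_right, ← hα, inner_eq, polarVec_zero, polarVec_one,
    mul_inv_cancel₀ hp.ne']
  field_simp
  rw [cross]
  ring

lemma inner_polarVec_right {p q : E} (h : 0 < cross p q) {β : ℝ} (hβ : q = ‖q‖ • dir β) :
    inner ℝ (polarVec p q) (dir β) = ‖q‖⁻¹ := by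
  have hq := (norm_pos_of_cross_pos h).2
  apply mul_left_cancel₀ hq.ne'
  rw [← real_inner_smul_right, ← hβ, inner_eq, polarVec_zero, polarVec_one,
    mul_inv_cancel₀ hq.ne']
  field_simp
  rw [cross]
  ring

/-- The contribution of the angular sector spanned by `p` and `q`. -/
lemma integral_sector {T : Set E} (hT : Convex ℝ T) {P p q : E}
    (hp : P + p ∈ T) (hq : P + q ∈ T) (hpq : 0 < cross p q)
    (hle : ∀ x ∈ T, cross p (x - P) + cross (x - P) q ≤ cross p q)
    {α β : ℝ} (hα : p = ‖p‖ • dir α) (hβ : q = ‖q‖ • dir β) (hαβ : α ≤ β) (hβα : β - α < π) :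
    IntervalIntegrable (fun φ => (sSup {r : ℝ | 0 ≤ r ∧ P + r • dir φ ∈ T})⁻¹ • dir φ)
      volume α β ∧
    ∫ φ in α..β, (sSup {r : ℝ | 0 ≤ r ∧ P + r • dir φ ∈ T})⁻¹ • dir φ =
      (2⁻¹ : ℝ) • ((β - α) • polarVec p q
        - (‖q‖⁻¹ • dir (β + π / 2) - ‖p‖⁻¹ • dir (α + π / 2))) := by
  have heq : Set.EqOn (fun φ => inner ℝ (polarVec p q) (dir φ) • dir φ)
      (fun φ => (sSup {r : ℝ | 0 ≤ r ∧ P + r • dir φ ∈ T})⁻¹ • dir φ) (Set.uIcc α β) := by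
    intro φ hφ
    rw [Set.uIcc_of_le hαβ] at hφ
    simp only
    rw [inv_radial_eq_inner hT hp hq hpq hle hα hβ hβα hφ]
  constructor
  · refine ((continuous_inner_smul_dir (polarVec p q)).intervalIntegrable _ _).congr ?_
    exact fun φ hφ => heq (Set.uIoc_subset_uIcc hφ)
  · rw [← intervalIntegral.integral_congr heq, integral_inner_smul_dir,
      inner_polarVec_left hpq hα, inner_polarVec_right hpq hβ]

lemma dir_add_two_pi (φ : ℝ) : dir (φ + 2 * π) = dir φ := by
  ext i
  fin_cases i <;> simp

/-- The gradient integral of a triangle is a combination of the polar vectors of its sides. -/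
lemma integral_inv_radial_smul_dir {T : Set E} (hT : Convex ℝ T) {P a b c : E}
    (ha : P + a ∈ T) (hb : P + b ∈ T) (hc : P + c ∈ T)
    (hab : 0 < cross a b) (hbc : 0 < cross b c) (hca : 0 < cross c a)
    (hab' : ∀ x ∈ T, cross a (x - P) + cross (x - P) b ≤ cross a b)
    (hbc' : ∀ x ∈ T, cross b (x - P) + cross (x - P) c ≤ cross b c)
    (hca' : ∀ x ∈ T, cross c (x - P) + cross (x - P) a ≤ cross c a) :
    ∫ φ in 0..(2 * π), (sSup {r : ℝ | 0 ≤ r ∧ P + r • dir φ ∈ T})⁻¹ • dir φ =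
      (2⁻¹ : ℝ) • (InnerProductGeometry.angle a b • polarVec a b
        + InnerProductGeometry.angle b c • polarVec b c
        + InnerProductGeometry.angle c a • polarVec c a) := by
  obtain ⟨α, hα⟩ := exists_eq_norm_smul_dir a
  have hβ := eq_norm_smul_dir_add_angle hab hα
  have hγ := eq_norm_smul_dir_add_angle hbc hβ
  have hδ := eq_norm_smul_dir_add_angle hca hγ
  have h1 := angle_mem_Ioo hab
  have h2 := angle_mem_Ioo hbc
  have h3 := angle_mem_Ioo hca
  have hsum := angle_add_angle_add_angle hab hbc hca
  set x := InnerProductGeometry.angle a b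
  set y := InnerProductGeometry.angle b c
  set z := InnerProductGeometry.angle c a
  have hend : α + x + y + z = α + 2 * π := by linarith
  obtain ⟨i1, e1⟩ := integral_sector hT ha hb hab hab' hα hβ (by linarith [h1.1])
    (by linarith [h1.2])
  obtain ⟨i2, e2⟩ := integral_sector hT hb hc hbc hbc' hβ hγ (by linarith [h2.1])
    (by linarith [h2.2])
  obtain ⟨i3, e3⟩ := integral_sector hT hc ha hca hca' hγ hδ (by linarith [h3.1])
    (by linarith [h3.2])
  have hper : Function.Periodic
      (fun φ => (sSup {r : ℝ | 0 ≤ r ∧ P + r • dir φ ∈ T})⁻¹ • dir φ) (2 * π) := by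
    intro φ
    simp only [dir_add_two_pi]
  have hshift := hper.intervalIntegral_add_eq 0 α
  rw [zero_add] at hshift
  rw [hshift, ← hend, ← intervalIntegral.integral_add_adjacent_intervals (i1.trans i2) i3,
    ← intervalIntegral.integral_add_adjacent_intervals i1 i2, e1, e2, e3, hend,
    add_right_comm α (2 * π), dir_add_two_pi, ← hend]
  module

open scoped Pointwise in
/-- Up to a universal constant, the area of a triangle is a determinant. -/
lemma exists_volume_triangle : ∃ K : ℝ, ∀ P a b : E,
    (volume (convexHull ℝ {P, P + a, P + b})).toReal = |cross a b| * K := by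
  refine ⟨(volume (convexHull ℝ {(0 : E), dir 0, dir (π / 2)})).toReal, fun P a b => ?_⟩
  let f : E →ₗ[ℝ] E := Matrix.toEuclideanLin !![a 0, b 0; a 1, b 1]
  have hdet : LinearMap.det f = cross a b := by
    have : LinearMap.det f = Matrix.det !![a 0, b 0; a 1, b 1] := by
      simp [f, Matrix.toLpLin_eq_toLin]
    rw [this, Matrix.det_fin_two_of, cross]
    ring
  have h0 : f (dir 0) = a := by
    ext i
    fin_cases i <;> simp [f, Matrix.toEuclideanLin, dir]
  have h1 : f (dir (π / 2)) = b := by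
    ext i
    fin_cases i <;> simp [f, Matrix.toEuclideanLin, dir]
  have himg : convexHull ℝ {P, P + a, P + b}
      = P +ᵥ (f '' convexHull ℝ {(0 : E), dir 0, dir (π / 2)}) := by
    rw [f.image_convexHull, ← convexHull_vadd]
    simp [Set.image_insert_eq, h0, h1, Set.vadd_set_insert]
  rw [himg, measure_vadd, Measure.addHaar_image_linearMap, hdet, ENNReal.toReal_mul,
    ENNReal.toReal_ofReal (abs_nonneg _)]

/-- The polar-vector relation determines its coefficients up to a common factor. -/
lemma coeff_eq_of_sum_smul_polarVec_eq_zero {a b c : E}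
    (hab : 0 < cross a b) (hbc : 0 < cross b c) (hca : 0 < cross c a) {x y z : ℝ}
    (h : x • polarVec a b + y • polarVec b c + z • polarVec c a = 0) :
    y / cross b c = z / cross c a ∧ z / cross c a = x / cross a b := by
  have e0 := congrArg (fun v : E => v 0) h
  have e1 := congrArg (fun v : E => v 1) h
  simp only [PiLp.add_apply, PiLp.smul_apply, polarVec_zero, polarVec_one, smul_eq_mul,
    PiLp.zero_apply, mul_div_left_comm x, mul_div_left_comm y, mul_div_left_comm z] at e0 e1
  set X := x / cross a b
  set Y := y / cross b c
  set Z := z / cross c a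
  have hD : 0 < cross a b + cross b c + cross c a := by positivity
  constructor <;> refine mul_right_cancel₀ hD.ne' ?_ <;> simp only [cross]
  · linear_combination (b 0 - a 0) * e0 + (b 1 - a 1) * e1
  · linear_combination (c 0 - b 0) * e0 + (c 1 - b 1) * e1

lemma cross_add_cross_le_of_mem_convexHull {P a b c x : E}
    (hab : 0 < cross a b) (hbc : 0 < cross b c) (hca : 0 < cross c a)
    (hx : x ∈ convexHull ℝ {P + a, P + b, P + c}) :
    cross a (x - P) + cross (x - P) b ≤ cross a b := by
  revert x
  change convexHull ℝ {P + a, P + b, P + c} ⊆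
    {x | cross a (x - P) + cross (x - P) b ≤ cross a b}
  refine convexHull_min ?_ ?_
  · rintro x (rfl | rfl | rfl)
    · simp [cross, mul_comm]
    · simp [cross, mul_comm]
    · simp only [Set.mem_ofPred_eq, add_sub_cancel_left]
      simp only [cross] at *
      linarith
  · intro x hx y hy s t hs ht hst
    obtain rfl : t = 1 - s := by linarith
    simp only [Set.mem_ofPred_eq] at *
    have e : cross a (s • x + (1 - s) • y - P) + cross (s • x + (1 - s) • y - P) b
        = s * (cross a (x - P) + cross (x - P) b)
          + (1 - s) * (cross a (y - P) + cross (y - P) b) := by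
      simp [cross]
      ring
    rw [e]
    nlinarith [mul_le_mul_of_nonneg_left hx hs, mul_le_mul_of_nonneg_left hy ht]

/-- The positively oriented case, with the interior point `P` as origin. -/
lemma ratio_eq_of_cross_pos {P a b c : E}
    (hab : 0 < cross a b) (hbc : 0 < cross b c) (hca : 0 < cross c a)
    (hstat : ∫ φ in 0..(2 * π), (sSup {r : ℝ | 0 ≤ r ∧
      P + r • dir φ ∈ convexHull ℝ {P + a, P + b, P + c}})⁻¹ • dir φ = 0) :
    InnerProductGeometry.angle b c / cross b c = InnerProductGeometry.angle c a / cross c a ∧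
    InnerProductGeometry.angle c a / cross c a = InnerProductGeometry.angle a b / cross a b := by
  have hsub := subset_convexHull ℝ ({P + a, P + b, P + c} : Set E)
  have hrot : ({P + b, P + c, P + a} : Set E) = {P + a, P + b, P + c} := by
    ext; simp; tauto
  have hrot' : ({P + c, P + a, P + b} : Set E) = {P + a, P + b, P + c} := by
    ext; simp; tauto
  rw [integral_inv_radial_smul_dir (convex_convexHull ℝ _) (hsub (by simp)) (hsub (by simp))
    (hsub (by simp)) hab hbc hca
    (fun x hx => cross_add_cross_le_of_mem_convexHull hab hbc hca hx)
    (fun x hx => cross_add_cross_le_of_mem_convexHull hbc hca hab (hrot ▸ hx))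
    (fun x hx => cross_add_cross_le_of_mem_convexHull hca hab hbc (hrot' ▸ hx))] at hstat
  exact coeff_eq_of_sum_smul_polarVec_eq_zero hab hbc hca
    ((smul_eq_zero.1 hstat).resolve_left (by norm_num))

/-- The signed areas seen from an interior point all have the orientation of the triangle. -/
lemma cross_sub_pos_or_neg {A B C P : E} (hABC : AffineIndependent ℝ ![A, B, C])
    (hP : P ∈ interior (convexHull ℝ {A, B, C})) :
    (0 < cross (A - P) (B - P) ∧ 0 < cross (B - P) (C - P) ∧ 0 < cross (C - P) (A - P)) ∨
    (cross (A - P) (B - P) < 0 ∧ cross (B - P) (C - P) < 0 ∧ cross (C - P) (A - P) < 0) := by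
  have htop : affineSpan ℝ (Set.range ![A, B, C]) = ⊤ := by
    rw [hABC.affineSpan_eq_top_iff_card_eq_finrank_add_one]
    simp
  let bas : AffineBasis (Fin 3) ℝ E := ⟨![A, B, C], hABC, htop⟩
  have hrange : ({A, B, C} : Set E) = Set.range bas := by
    change _ = Set.range ![A, B, C]
    rw [Matrix.range_cons, Matrix.range_cons, Matrix.range_cons, Matrix.range_empty,
      Set.union_empty]
    rfl
  rw [hrange, bas.interior_convexHull] at hP
  have hsum := bas.sum_coord_apply_eq_one P
  have hcomb := bas.linear_combination_coord_eq_self P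
  have hA : bas 0 = A := rfl
  have hB : bas 1 = B := rfl
  have hC : bas 2 = C := rfl
  rw [Fin.sum_univ_three] at hsum hcomb
  rw [hA, hB, hC] at hcomb
  have hx := hP 0
  have hy := hP 1
  have hz := hP 2
  set x := bas.coord 0 P
  set y := bas.coord 1 P
  set z := bas.coord 2 P
  clear_value x y z
  obtain rfl : x = 1 - y - z := by linarith
  have e1 : cross (A - P) (B - P) = z * cross (B - A) (C - A) := by
    rw [← hcomb]
    simp [cross]
    ring
  have e2 : cross (B - P) (C - P) = (1 - y - z) * cross (B - A) (C - A) := by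
    rw [← hcomb]
    simp [cross]
    ring
  have e3 : cross (C - P) (A - P) = y * cross (B - A) (C - A) := by
    rw [← hcomb]
    simp [cross]
    ring
  have hinj := hABC.injective
  have hne : cross (B - A) (C - A) ≠ 0 := by
    intro h0
    rw [cross] at h0
    simp only [PiLp.sub_apply] at h0
    rw [affineIndependent_iff] at hABC
    have h1 := hABC Finset.univ ![B 1 - C 1, C 1 - A 1, A 1 - B 1]
      (by simp [Fin.sum_univ_three]) (by
        ext i
        fin_cases i
        · simp [Fin.sum_univ_three]
          linear_combination h0
        · simp [Fin.sum_univ_three]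
          ring)
    have h2 := hABC Finset.univ ![B 0 - C 0, C 0 - A 0, A 0 - B 0]
      (by simp [Fin.sum_univ_three]) (by
        ext i
        fin_cases i
        · simp [Fin.sum_univ_three]
          ring
        · simp [Fin.sum_univ_three]
          linear_combination -h0)
    have h3 := h1 2 (Finset.mem_univ _)
    have h4 := h2 2 (Finset.mem_univ _)
    simp only [Matrix.cons_val] at h3 h4
    have hAB : A = B := by
      ext i
      fin_cases i
      · exact sub_eq_zero.1 h4
      · exact sub_eq_zero.1 h3
    exact absurd (hinj (a₁ := 0) (a₂ := 1) hAB) (by decide)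
  rw [e1, e2, e3]
  rcases hne.lt_or_gt with h | h
  · exact Or.inr ⟨mul_neg_of_pos_of_neg hz h, mul_neg_of_pos_of_neg hx h,
      mul_neg_of_pos_of_neg hy h⟩
  · exact Or.inl ⟨mul_pos hz h, mul_pos hx h, mul_pos hy h⟩

end IlluminatingCenter

open IlluminatingCenter in
theorem illuminating_center_characterization
    (A B C : EuclideanSpace ℝ (Fin 2))
    (hABC : AffineIndependent ℝ ![A, B, C])
    (T : Set (EuclideanSpace ℝ (Fin 2)))
    (hT : T = convexHull ℝ {A, B, C})
    (P : EuclideanSpace ℝ (Fin 2)) (hP : P ∈ interior T)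
    (u : ℝ → EuclideanSpace ℝ (Fin 2))
    (hu : ∀ φ, u φ = (WithLp.equiv 2 (Fin 2 → ℝ)).symm ![Real.cos φ, Real.sin φ])
    (R : ℝ → ℝ)
    (hR : ∀ φ, R φ = sSup {r : ℝ | 0 ≤ r ∧ P + r • u φ ∈ T})
    (hstat : ∫ φ in (0)..(2 * π), (R φ)⁻¹ • (u φ) = 0) :
    (∠ B P C) / (volume (convexHull ℝ {P, B, C})).toReal
      = (∠ C P A) / (volume (convexHull ℝ {P, C, A})).toReal ∧
    (∠ C P A) / (volume (convexHull ℝ {P, C, A})).toReal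
      = (∠ A P B) / (volume (convexHull ℝ {P, A, B})).toReal := by
  obtain rfl : u = dir := funext hu
  subst hT
  obtain rfl : R = _ := funext hR
  obtain ⟨K, hK⟩ := exists_volume_triangle
  have hBC := hK P (B - P) (C - P)
  have hCA := hK P (C - P) (A - P)
  have hAB := hK P (A - P) (B - P)
  have hsgn := cross_sub_pos_or_neg hABC hP
  have hswap : ({A, B, C} : Set (EuclideanSpace ℝ (Fin 2))) = {A, C, B} := by
    ext; simp; tauto
  simp only [add_sub_cancel] at hBC hCA hAB
  rw [hBC, hCA, hAB]
  simp only [EuclideanGeometry.angle, vsub_eq_sub, ← div_div]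
  rcases hsgn with ⟨h1, h2, h3⟩ | ⟨h1, h2, h3⟩
  · rw [abs_of_pos h1, abs_of_pos h2, abs_of_pos h3]
    obtain ⟨e1, e2⟩ := ratio_eq_of_cross_pos (P := P) (a := A - P) (b := B - P) (c := C - P)
      h1 h2 h3 (by simpa using hstat)
    rw [e1, e2]
    exact ⟨rfl, rfl⟩
  · rw [abs_of_neg h1, abs_of_neg h2, abs_of_neg h3]
    have hneg (p q : EuclideanSpace ℝ (Fin 2)) : -cross p q = cross q p := by
      rw [cross, cross]
      ring
    rw [← neg_pos, hneg] at h1 h2 h3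
    rw [hneg, hneg, hneg]
    simp only [hswap] at hstat
    obtain ⟨e1, e2⟩ := ratio_eq_of_cross_pos (P := P) (a := A - P) (b := C - P) (c := B - P)
      h3 h2 h1 (by simpa using hstat)
    rw [InnerProductGeometry.angle_comm (B - P) (C - P),
      InnerProductGeometry.angle_comm (C - P) (A - P),
      InnerProductGeometry.angle_comm (A - P) (B - P)]
    rw [e1, e2]
    exact ⟨rfl, rfl⟩
end
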